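/- A positive integer n can be written as n = a² + ab + b² with a and b nonnegative integers if and only if in the prime factorization of n, every prime other than 3 that is not congruent to 1 modulo 6 occurs with an even exponent. -/

import Mathlib

/-- An integer represented by the form `a² + ab + b²` is represented with `a, b` nonnegative. -/
theorem exists_nat_eq_sq_add_mul_add_sq {n : ℕ} {a b : ℤ} (h : (n : ℤ) = a ^ 2 + a * b + b ^ 2) :
    ∃ c d : ℕ, n = c ^ 2 + c * d + d ^ 2 := by
  have of_nonneg {x y : ℤ} (hx : 0 ≤ x) (hy : 0 ≤ y) (hxy : (n : ℤ) = x ^ 2 + x * y + y ^ 2) :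
      ∃ c d : ℕ, n = c ^ 2 + c * d + d ^ 2 := by
    lift x to ℕ using hx
    lift y to ℕ using hy
    exact ⟨x, y, by exact_mod_cast hxy⟩
  rcases le_total 0 a with ha | ha <;> rcases le_total 0 b with hb | hb
  · exact of_nonneg ha hb h
  · rcases le_total 0 (a + b) with hab | hab
    · exact of_nonneg hab (neg_nonneg.2 hb) (by rw [h]; ring)
    · exact of_nonneg ha (neg_nonneg.2 hab) (by rw [h]; ring)
  · rcases le_total 0 (a + b) with hab | hab
    · exact of_nonneg hab (neg_nonneg.2 ha) (by rw [h]; ring)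
    · exact of_nonneg hb (neg_nonneg.2 hab) (by rw [h]; ring)
  · exact of_nonneg (neg_nonneg.2 ha) (neg_nonneg.2 hb) (by rw [h]; ring)

/-- The set of values of the form `a² + ab + b²` is closed under multiplication. -/
theorem sq_add_mul_add_sq_mul {m n : ℕ} (hm : ∃ a b : ℕ, m = a ^ 2 + a * b + b ^ 2)
    (hn : ∃ a b : ℕ, n = a ^ 2 + a * b + b ^ 2) :
    ∃ a b : ℕ, m * n = a ^ 2 + a * b + b ^ 2 := by
  obtain ⟨a, b, rfl⟩ := hm
  obtain ⟨c, d, rfl⟩ := hn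
  apply exists_nat_eq_sq_add_mul_add_sq (a := a * c - b * d) (b := a * d + b * c + b * d)
  push_cast
  ring

theorem sq_add_mul_add_sq_pow {m : ℕ} (hm : ∃ a b : ℕ, m = a ^ 2 + a * b + b ^ 2) (k : ℕ) :
    ∃ a b : ℕ, m ^ k = a ^ 2 + a * b + b ^ 2 := by
  induction k with
  | zero => exact ⟨1, 0, by norm_num⟩
  | succ k ih => rw [pow_succ]; exact sq_add_mul_add_sq_mul ih hm

/-- A prime `p ≡ 2 mod 3` dividing `a² + ab + b²` divides both `a` and `b`. -/
theorem Nat.Prime.dvd_and_dvd_of_dvd_sq_add_mul_add_sq {p : ℕ} (hp : p.Prime) (h3 : p % 3 = 2)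
    {a b : ℤ} (h : (p : ℤ) ∣ a ^ 2 + a * b + b ^ 2) : (p : ℤ) ∣ a ∧ (p : ℤ) ∣ b := by
  have := Fact.mk hp
  rw [← ZMod.intCast_zmod_eq_zero_iff_dvd] at h
  rw [← ZMod.intCast_zmod_eq_zero_iff_dvd, ← ZMod.intCast_zmod_eq_zero_iff_dvd]
  push_cast at h
  generalize (a : ZMod p) = x at h ⊢
  generalize (b : ZMod p) = y at h ⊢
  by_cases hx : x = 0
  · subst hx
    simpa using h
  by_cases hy : y = 0
  · subst hy
    simpa using h
  exfalso
  have hcube : x ^ 3 = y ^ 3 := by linear_combination (x - y) * h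
  obtain ⟨k, hk⟩ : ∃ k, p - 1 = 3 * k + 1 := ⟨p / 3, by omega⟩
  have hxk := ZMod.pow_card_sub_one_eq_one hx
  have hyk := ZMod.pow_card_sub_one_eq_one hy
  rw [hk, pow_succ, pow_mul] at hxk hyk
  rw [hcube, ← hyk] at hxk
  have hxy : x = y := mul_left_cancel₀ (pow_ne_zero _ (pow_ne_zero _ hy)) hxk
  subst hxy
  have h3x : (3 : ZMod p) * x ^ 2 = 0 := by linear_combination h
  rcases _root_.mul_eq_zero.1 h3x with h0 | h0
  · have hdvd : p ∣ 3 := (ZMod.natCast_eq_zero_iff 3 p).1 (by exact_mod_cast h0)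
    rw [(Nat.prime_dvd_prime_iff_eq hp Nat.prime_three).1 hdvd] at h3
    omega
  · exact hx (pow_eq_zero_iff two_ne_zero |>.1 h0)

/-- Primes `p ≡ 2 mod 3` occur with even exponent in a nonzero value of `a² + ab + b²`. -/
theorem Nat.Prime.even_factorization_sq_add_mul_add_sq {p : ℕ} (hp : p.Prime) (h3 : p % 3 = 2)
    (n : ℕ) (hn : n ≠ 0) (h : ∃ a b : ℕ, n = a ^ 2 + a * b + b ^ 2) :
    Even (n.factorization p) := by
  induction n using Nat.strong_induction_on with
  | _ n ih =>
    by_cases hpn : p ∣ n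
    · obtain ⟨a, b, rfl⟩ := h
      obtain ⟨ha, hb⟩ := hp.dvd_and_dvd_of_dvd_sq_add_mul_add_sq (a := a) (b := b) h3
        (by exact_mod_cast hpn)
      obtain ⟨c, rfl⟩ := Int.natCast_dvd_natCast.1 ha
      obtain ⟨d, rfl⟩ := Int.natCast_dvd_natCast.1 hb
      have heq : (p * c) ^ 2 + p * c * (p * d) + (p * d) ^ 2 =
          p ^ 2 * (c ^ 2 + c * d + d ^ 2) := by ring
      rw [heq] at hn ih ⊢
      have hm : c ^ 2 + c * d + d ^ 2 ≠ 0 := right_ne_zero_of_mul hn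
      have hlt : c ^ 2 + c * d + d ^ 2 < p ^ 2 * (c ^ 2 + c * d + d ^ 2) :=
        lt_mul_of_one_lt_left (Nat.pos_of_ne_zero hm) (Nat.one_lt_pow two_ne_zero hp.one_lt)
      have heven := ih _ hlt hm ⟨c, d, rfl⟩
      rw [Nat.factorization_mul (pow_ne_zero _ hp.ne_zero) hm, hp.factorization_pow]
      simpa using even_two.add heven
    · rw [Nat.factorization_eq_zero_of_not_dvd hpn]
      exact Even.zero

theorem ZMod.exists_sq_add_self_add_one_eq_zero {p : ℕ} [Fact p.Prime] (h3 : p % 3 = 1) :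
    ∃ x : ZMod p, x ^ 2 + x + 1 = 0 := by
  have := Fact.mk Nat.prime_three
  have hcard : 3 ∣ Fintype.card (ZMod p)ˣ := by
    rw [ZMod.card_units]
    omega
  obtain ⟨u, hu⟩ := exists_prime_orderOf_dvd_card 3 hcard
  have hu3 : ((u : ZMod p)) ^ 3 = 1 := by
    rw [← Units.val_pow_eq_pow_val, ← hu, pow_orderOf_eq_one, Units.val_one]
  have hu1 : (u : ZMod p) - 1 ≠ 0 := by
    intro h
    have : u = 1 := Units.ext (sub_eq_zero.1 h)
    simp [this] at hu
  exact ⟨u, mul_left_cancel₀ hu1 (by linear_combination hu3)⟩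

/-- **Thue's lemma**, for the modulus `n` and bound `√n`. -/
theorem ZMod.exists_intCast_eq_mul_intCast_sq_le (n : ℕ) [NeZero n] (x : ZMod n) :
    ∃ a b : ℤ, (a ≠ 0 ∨ b ≠ 0) ∧ a ^ 2 ≤ n ∧ b ^ 2 ≤ n ∧ (a : ZMod n) = x * b := by
  set s := Nat.sqrt n
  have hcard : (Finset.univ : Finset (ZMod n)).card <
      (Finset.range (s + 1) ×ˢ Finset.range (s + 1)).card := by
    simpa [ZMod.card] using Nat.lt_succ_sqrt n
  obtain ⟨⟨u, v⟩, huv, ⟨u', v'⟩, huv', hne, heq⟩ :=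
    Finset.exists_ne_map_eq_of_card_lt_of_maps_to hcard
      (f := fun q : ℕ × ℕ => (q.1 : ZMod n) - x * q.2)
      (fun _ _ => Finset.mem_coe.2 (Finset.mem_univ _))
  simp only [Finset.mem_product, Finset.mem_range] at huv huv'
  have hs : (s : ℤ) ^ 2 ≤ n := by exact_mod_cast Nat.sqrt_le' n
  refine ⟨(u : ℤ) - u', (v : ℤ) - v', ?_, ?_, ?_, ?_⟩
  · by_contra! h
    exact hne (Prod.ext (by simpa using by omega) (by simpa using by omega))
  · exact (sq_le_sq' (by omega) (by omega)).trans hs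
  · exact (sq_le_sq' (by omega) (by omega)).trans hs
  · push_cast
    linear_combination heq

/-- Every prime `p ≡ 1 mod 3` is of the form `a² + ab + b²`. -/
theorem Nat.Prime.eq_sq_add_mul_add_sq {p : ℕ} (hp : p.Prime) (h3 : p % 3 = 1) :
    ∃ a b : ℕ, p = a ^ 2 + a * b + b ^ 2 := by
  have := Fact.mk hp
  obtain ⟨x, hx⟩ := ZMod.exists_sq_add_self_add_one_eq_zero h3
  obtain ⟨a, b, hab, ha, hb, hxab⟩ := ZMod.exists_intCast_eq_mul_intCast_sq_le p x
  have ne_sq (c : ℤ) : c ^ 2 ≠ p := fun h =>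
    (Nat.prime_iff_prime_int.1 hp).not_isSquare ⟨c, by rw [← h, sq]⟩
  have ha' : a ^ 2 < p := lt_of_le_of_ne ha (ne_sq a)
  have hb' : b ^ 2 < p := lt_of_le_of_ne hb (ne_sq b)
  have hdvd : (p : ℤ) ∣ a ^ 2 + a * b + b ^ 2 := by
    rw [← ZMod.intCast_zmod_eq_zero_iff_dvd]
    push_cast
    rw [hxab]
    linear_combination (b : ZMod p) ^ 2 * hx
  obtain ⟨k, hk⟩ := hdvd
  have hp0 : (0 : ℤ) < p := by exact_mod_cast hp.pos
  have hpos : 0 < a ^ 2 + a * b + b ^ 2 := by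
    rcases hab with h | h
    · nlinarith [sq_nonneg (a + 2 * b), sq_pos_of_ne_zero h]
    · nlinarith [sq_nonneg (2 * a + b), sq_pos_of_ne_zero h]
  have hk0 : 0 < k := by
    rw [hk] at hpos
    exact pos_of_mul_pos_right hpos hp0.le
  have hk3 : k < 3 := by nlinarith [sq_nonneg (a - b)]
  obtain rfl | rfl : k = 1 ∨ k = 2 := by omega
  · exact exists_nat_eq_sq_add_mul_add_sq (a := a) (b := b) (by linarith)
  · obtain ⟨⟨c, rfl⟩, ⟨d, rfl⟩⟩ :=
      Nat.prime_two.dvd_and_dvd_of_dvd_sq_add_mul_add_sq rfl (a := a) (b := b)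
        ⟨p, by rw [hk]; push_cast; ring⟩
    have h2 : (p : ℤ) = 2 * (c ^ 2 + c * d + d ^ 2) := by
      push_cast at hk
      linarith
    have h2p : 2 ∣ p := by
      have : (2 : ℤ) ∣ p := ⟨_, h2⟩
      exact_mod_cast this
    rw [← (Nat.prime_dvd_prime_iff_eq Nat.prime_two hp).1 h2p] at h3
    omega

theorem bnum_iff_even_exponents (n : ℕ) (hn : 0 < n) :
    (∃ a b : ℕ, n = a^2 + a*b + b^2) ↔
      ∀ p : ℕ, p.Prime → p ≠ 3 → p % 6 ≠ 1 → Even (n.factorization p) := by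
  constructor
  · intro h p hp hp3 hp6
    have hdvd3 : ¬ 3 ∣ p := fun h => hp3 ((Nat.prime_dvd_prime_iff_eq Nat.prime_three hp).1 h).symm
    have hodd := hp.eq_two_or_odd
    exact hp.even_factorization_sq_add_mul_add_sq (by omega) n hn.ne' h
  · intro h
    rw [← Nat.prod_factorization_pow_eq_self hn.ne']
    refine Finset.prod_induction _ (fun m => ∃ a b : ℕ, m = a ^ 2 + a * b + b ^ 2)
      (fun _ _ => sq_add_mul_add_sq_mul) ⟨1, 0, by norm_num⟩ fun p hpn => ?_
    have hp : p.Prime := Nat.prime_of_mem_primeFactors hpn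
    by_cases hp3 : p = 3
    · exact sq_add_mul_add_sq_pow ⟨1, 1, by omega⟩ _
    by_cases hp6 : p % 6 = 1
    · exact sq_add_mul_add_sq_pow (hp.eq_sq_add_mul_add_sq (by omega)) _
    · obtain ⟨k, hk⟩ := h p hp hp3 hp6
      exact ⟨p ^ k, 0, by simp only [hk]; ring⟩
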